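/- arXiv:2010.06036 — 2 statements merged into one kernel-verified Lean document; each statement's English description precedes it below -/
import Mathlib

section
/- Let $M$ be a subgroup of $\mathbb{Z}^n$ and $N$ a positive integer with $N\,\mathbb{Z}^n \subseteq M$. Let $\varphi : \mathbb{Z}^n\setminus\{0\} \to \mathbb{R}_{>0}$ be a function, and let $\xi, \eta > 0$ satisfy $\varphi(y) \le \xi$ for all $y \in M\setminus\{0\}$ and $\varphi(y) \ge \eta$ for all $y \in \mathbb{Z}^n\setminus M$. Let $\tau > \sqrt{\xi/\eta}\,N$, and define $\varphi_\tau(x) = \varphi(x)$ if $x \in M\setminus\{0\}$ and $\varphi_\tau(x) = \tau^2\varphi(x)$ if $x \in \mathbb{Z}^n\setminus M$. Let $Z$ be an $n\times n$ positive definite real symmetric matrix. Then every $x \in \mathbb{Z}^n\setminus\{0\}$ such that $\varphi_\tau(x)\,Z[x] \le \varphi_\tau(y)\,Z[y]$ for all $y \in \mathbb{Z}^n\setminus\{0\}$ lies in $M$. -/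
open Matrix
open scoped Classical

theorem stmt0 {n : ℕ} (M : AddSubgroup (Fin n → ℤ)) (N : ℕ) (hN : 0 < N)
    (hNM : ∀ x : Fin n → ℤ, (N : ℤ) • x ∈ M)
    (φ : (Fin n → ℤ) → ℝ) (hφ : ∀ x : Fin n → ℤ, x ≠ 0 → 0 < φ x)
    (ξ η : ℝ) (hξ : 0 < ξ) (hη : 0 < η)
    (hφξ : ∀ y : Fin n → ℤ, y ∈ M → y ≠ 0 → φ y ≤ ξ)
    (hφη : ∀ y : Fin n → ℤ, y ∉ M → η ≤ φ y)
    (τ : ℝ) (hτ : Real.sqrt (ξ / η) * N < τ)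
    (φτ : (Fin n → ℤ) → ℝ)
    (hφτ : ∀ x : Fin n → ℤ, φτ x = if x ∈ M then φ x else τ ^ 2 * φ x)
    (Z : Matrix (Fin n) (Fin n) ℝ) (hZsym : Z.IsSymm)
    (hZpd : ∀ v : Fin n → ℝ, v ≠ 0 → 0 < Matrix.vecMul v Z ⬝ᵥ v)
    (x : Fin n → ℤ) (hx : x ≠ 0)
    (hmin : ∀ y : Fin n → ℤ, y ≠ 0 →
      φτ x * (Matrix.vecMul (fun i => (x i : ℝ)) Z ⬝ᵥ fun i => (x i : ℝ)) ≤
        φτ y * (Matrix.vecMul (fun i => (y i : ℝ)) Z ⬝ᵥ fun i => (y i : ℝ))) :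
    x ∈ M := by
  by_contra hxM
  have hy : (N : ℤ) • x ≠ 0 := smul_ne_zero (by exact_mod_cast hN.ne') hx
  have hxR : (fun i => (x i : ℝ)) ≠ 0 := fun h =>
    hx (funext fun i => by simpa using congrFun h i)
  have hmul : (fun i => ((((N : ℤ) • x) i : ℤ) : ℝ)) = (N : ℝ) • fun i => (x i : ℝ) := by
    ext i
    simp
  have hle := hmin _ hy
  have hq := hZpd _ hxR
  rw [hφτ, hφτ, if_neg hxM, if_pos (hNM x), hmul, Matrix.smul_vecMul, smul_dotProduct,
    dotProduct_smul, smul_eq_mul, smul_eq_mul] at hle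
  generalize Matrix.vecMul (fun i => (x i : ℝ)) Z ⬝ᵥ (fun i => (x i : ℝ)) = q at hle hq
  have hcoef : τ ^ 2 * φ x ≤ φ ((N : ℤ) • x) * (N : ℝ) ^ 2 :=
    le_of_mul_le_mul_right (by linarith) hq
  have hsq : ξ / η * (N : ℝ) ^ 2 < τ ^ 2 := by
    have h := pow_lt_pow_left₀ hτ (by positivity) two_ne_zero
    rwa [mul_pow, Real.sq_sqrt (by positivity)] at h
  have hlt : ξ * (N : ℝ) ^ 2 < τ ^ 2 * η := by
    rwa [div_mul_eq_mul_div, div_lt_iff₀ hη] at hsq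
  have hupper := mul_le_mul_of_nonneg_right (hφξ _ (hNM x) hy) (sq_nonneg (N : ℝ))
  have hlower := mul_le_mul_of_nonneg_left (hφη x hxM) (sq_nonneg τ)
  linarith
end

section
/- Let $a$ be an $n\times n$ integer matrix with $\det a \neq 0$, let $M_0 = \{ y a : y \in \mathbb{Z}^n \}$, and let $N$ be a positive integer with $N\,\mathbb{Z}^n \subseteq M_0$. Let $\tau > N$ and let $Z$ be an $n\times n$ positive definite real symmetric matrix. Then the set of minimal vectors satisfies $M_\tau(Z) = \{\, y a : y \in \mathbb{Z}^n\setminus\{0\},\ (aZa^{\mathsf{T}})[y] = \min\{(aZa^{\mathsf{T}})[y'] : y' \in \mathbb{Z}^n\setminus\{0\}\} \,\}$; that is, $x \mapsto x a^{-1}$ carries the minimal vectors of $Z$ at temperament $\tau$ bijectively onto the minimal vectors of the form $aZa^{\mathsf{T}}$ at temperament $1$. -/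
open Matrix
open scoped Classical

/-- The weighted quadratic form `φ_τ(x) Z[x]` with weight `1` on `M0` and `τ²` off `M0`. -/
noncomputable def weightedForm {n : ℕ} (M0 : Set (Fin n → ℤ)) (τ : ℝ)
    (Z : Matrix (Fin n) (Fin n) ℝ) (x : Fin n → ℤ) : ℝ :=
  (if x ∈ M0 then (1 : ℝ) else τ ^ 2) *
    (Matrix.vecMul (fun i => (x i : ℝ)) Z ⬝ᵥ fun i => (x i : ℝ))

/-- `m_τ(Z)`, the arithmetic minimum at temperament `τ`. -/
noncomputable def arithMin {n : ℕ} (M0 : Set (Fin n → ℤ)) (τ : ℝ)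
    (Z : Matrix (Fin n) (Fin n) ℝ) : ℝ :=
  sInf {r : ℝ | ∃ x : Fin n → ℤ, x ≠ 0 ∧ r = weightedForm M0 τ Z x}

/-- `M_τ(Z)`, the set of minimal vectors at temperament `τ`. -/
noncomputable def minVecs {n : ℕ} (M0 : Set (Fin n → ℤ)) (τ : ℝ)
    (Z : Matrix (Fin n) (Fin n) ℝ) : Set (Fin n → ℤ) :=
  {x : Fin n → ℤ | x ≠ 0 ∧ weightedForm M0 τ Z x = arithMin M0 τ Z}

/-- A coinitial subset of a set of reals that is bounded below has the same infimum. -/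
theorem csInf_eq_of_subset_of_forall_exists_le {S T : Set ℝ} (hST : S ⊆ T) (hT : BddBelow T)
    (h : ∀ t ∈ T, ∃ s ∈ S, s ≤ t) : sInf T = sInf S := by
  rcases S.eq_empty_or_nonempty with rfl | hS
  · have hempty : T = ∅ := Set.eq_empty_of_forall_notMem fun t ht => by
      obtain ⟨s, hs, -⟩ := h t ht
      exact hs
    rw [hempty]
  · refine le_antisymm (csInf_le_csInf hT hS hST) (le_csInf (hS.mono hST) fun t ht => ?_)
    obtain ⟨s, hs, hst⟩ := h t ht
    exact (csInf_le (hT.mono hST) hs).trans hst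

theorem weightedForm_of_mem {n : ℕ} {M0 : Set (Fin n → ℤ)} {τ : ℝ}
    {Z : Matrix (Fin n) (Fin n) ℝ} {x : Fin n → ℤ} (hx : x ∈ M0) :
    weightedForm M0 τ Z x =
      Matrix.vecMul (fun i => (x i : ℝ)) Z ⬝ᵥ fun i => (x i : ℝ) := by
  simp [weightedForm, hx]

theorem quadForm_intCast_pos {n : ℕ} {Z : Matrix (Fin n) (Fin n) ℝ}
    (hZ : ∀ v : Fin n → ℝ, v ≠ 0 → 0 < Matrix.vecMul v Z ⬝ᵥ v) {x : Fin n → ℤ} (hx : x ≠ 0) :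
    0 < Matrix.vecMul (fun i => (x i : ℝ)) Z ⬝ᵥ fun i => (x i : ℝ) := by
  refine hZ _ fun h => hx (funext fun i => ?_)
  simpa using congrFun h i

theorem weightedForm_nonneg {n : ℕ} (M0 : Set (Fin n → ℤ)) (τ : ℝ)
    {Z : Matrix (Fin n) (Fin n) ℝ}
    (hZ : ∀ v : Fin n → ℝ, v ≠ 0 → 0 < Matrix.vecMul v Z ⬝ᵥ v) {x : Fin n → ℤ} (hx : x ≠ 0) :
    0 ≤ weightedForm M0 τ Z x := by
  refine mul_nonneg ?_ (quadForm_intCast_pos hZ hx).le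
  split_ifs <;> positivity

/-- Off `M0`, multiplying a vector by `N < τ` so as to land in `M0` strictly decreases the
weighted form. -/
theorem weightedForm_natCast_smul_lt {n : ℕ} {M0 : Set (Fin n → ℤ)} {N : ℕ} {τ : ℝ}
    (hτ : (N : ℝ) < τ) {Z : Matrix (Fin n) (Fin n) ℝ}
    (hZ : ∀ v : Fin n → ℝ, v ≠ 0 → 0 < Matrix.vecMul v Z ⬝ᵥ v) {x : Fin n → ℤ} (hx : x ≠ 0)
    (hxM : x ∉ M0) (hNx : (N : ℤ) • x ∈ M0) :
    weightedForm M0 τ Z ((N : ℤ) • x) < weightedForm M0 τ Z x := by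
  have hcast : (fun i => ((((N : ℤ) • x) i : ℤ) : ℝ)) = (N : ℝ) • fun i => (x i : ℝ) := by
    ext i
    simp
  rw [weightedForm_of_mem hNx, hcast, Matrix.smul_vecMul, smul_dotProduct, dotProduct_smul,
    smul_smul, smul_eq_mul, weightedForm, if_neg hxM, ← sq]
  have hsq : (N : ℝ) ^ 2 < τ ^ 2 := pow_lt_pow_left₀ hτ N.cast_nonneg two_ne_zero
  exact mul_lt_mul_of_pos_right hsq (quadForm_intCast_pos hZ hx)

/-- `(a Z aᵀ)[y] = Z[y a]`. -/
theorem quadForm_conj_intCast {n : ℕ} (a : Matrix (Fin n) (Fin n) ℤ)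
    (Z : Matrix (Fin n) (Fin n) ℝ) (y : Fin n → ℤ) :
    (Matrix.vecMul (fun i => (y i : ℝ))
        (a.map (Int.cast : ℤ → ℝ) * Z * (a.map (Int.cast : ℤ → ℝ))ᵀ) ⬝ᵥ fun i => (y i : ℝ)) =
      Matrix.vecMul (fun i => ((Matrix.vecMul y a i : ℤ) : ℝ)) Z ⬝ᵥ
        fun i => ((Matrix.vecMul y a i : ℤ) : ℝ) := by
  have hcast : (fun i => ((Matrix.vecMul y a i : ℤ) : ℝ)) =
      Matrix.vecMul (fun i => (y i : ℝ)) (a.map (Int.cast : ℤ → ℝ)) := by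
    ext i
    simp [Matrix.vecMul, dotProduct]
  rw [hcast, ← Matrix.vecMul_vecMul, ← Matrix.vecMul_vecMul, ← Matrix.dotProduct_mulVec,
    Matrix.mulVec_transpose]

theorem stmt2 {n : ℕ} (a : Matrix (Fin n) (Fin n) ℤ) (ha : a.det ≠ 0)
    (M0 : Set (Fin n → ℤ))
    (hM0 : M0 = Set.range fun y : Fin n → ℤ => Matrix.vecMul y a)
    (N : ℕ) (hN : 0 < N) (hNM : ∀ x : Fin n → ℤ, (N : ℤ) • x ∈ M0)
    (τ : ℝ) (hτ : (N : ℝ) < τ)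
    (Z : Matrix (Fin n) (Fin n) ℝ) (hZsym : Z.IsSymm)
    (hZpd : ∀ v : Fin n → ℝ, v ≠ 0 → 0 < Matrix.vecMul v Z ⬝ᵥ v)
    (A : Matrix (Fin n) (Fin n) ℝ)
    (hA : A = a.map (Int.cast : ℤ → ℝ) * Z * (a.map (Int.cast : ℤ → ℝ))ᵀ) :
    minVecs M0 τ Z =
      {x : Fin n → ℤ | ∃ y : Fin n → ℤ, y ≠ 0 ∧ x = Matrix.vecMul y a ∧
        (Matrix.vecMul (fun i => (y i : ℝ)) A ⬝ᵥ fun i => (y i : ℝ)) =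
          sInf {r : ℝ | ∃ y' : Fin n → ℤ, y' ≠ 0 ∧
            r = Matrix.vecMul (fun i => (y' i : ℝ)) A ⬝ᵥ fun i => (y' i : ℝ)}} := by
  have hform (y : Fin n → ℤ) : weightedForm M0 τ Z (Matrix.vecMul y a) =
      Matrix.vecMul (fun i => (y i : ℝ)) A ⬝ᵥ fun i => (y i : ℝ) := by
    rw [hA, quadForm_conj_intCast, weightedForm_of_mem (hM0 ▸ ⟨y, rfl⟩)]
  have hvec {y : Fin n → ℤ} (hy : y ≠ 0) : Matrix.vecMul y a ≠ 0 :=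
    fun h => hy (Matrix.eq_zero_of_vecMul_eq_zero ha h)
  have hexists {x : Fin n → ℤ} (hx : x ≠ 0) (hxM : x ∈ M0) :
      ∃ y : Fin n → ℤ, y ≠ 0 ∧ x = Matrix.vecMul y a := by
    rw [hM0] at hxM
    obtain ⟨y, rfl⟩ := hxM
    exact ⟨y, fun h => hx (by simp [h]), rfl⟩
  have hNx {x : Fin n → ℤ} (hx : x ≠ 0) : (N : ℤ) • x ≠ 0 :=
    smul_ne_zero (by exact_mod_cast hN.ne') hx
  have hbdd : BddBelow {r : ℝ | ∃ x : Fin n → ℤ, x ≠ 0 ∧ r = weightedForm M0 τ Z x} := by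
    refine ⟨0, ?_⟩
    rintro _ ⟨x, hx, rfl⟩
    exact weightedForm_nonneg M0 τ hZpd hx
  have hmin : arithMin M0 τ Z = sInf {r : ℝ | ∃ y' : Fin n → ℤ, y' ≠ 0 ∧
      r = Matrix.vecMul (fun i => (y' i : ℝ)) A ⬝ᵥ fun i => (y' i : ℝ)} := by
    refine csInf_eq_of_subset_of_forall_exists_le ?_ hbdd ?_
    · rintro _ ⟨y, hy, rfl⟩
      exact ⟨_, hvec hy, (hform y).symm⟩
    · rintro _ ⟨x, hx, rfl⟩
      by_cases hxM : x ∈ M0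
      · obtain ⟨y, hy, rfl⟩ := hexists hx hxM
        exact ⟨_, ⟨y, hy, rfl⟩, (hform y).ge⟩
      · obtain ⟨y, hy, hxy⟩ := hexists (hNx hx) (hNM x)
        refine ⟨_, ⟨y, hy, rfl⟩, ?_⟩
        rw [← hform, ← hxy]
        exact (weightedForm_natCast_smul_lt hτ hZpd hx hxM (hNM x)).le
  ext x
  simp only [minVecs, Set.mem_ofPred_eq, ← hmin]
  constructor
  · rintro ⟨hx, hxmin⟩
    have hxM : x ∈ M0 := by
      by_contra hxM
      have hlt := weightedForm_natCast_smul_lt hτ hZpd hx hxM (hNM x)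
      rw [hxmin] at hlt
      exact hlt.not_ge (csInf_le hbdd ⟨_, hNx hx, rfl⟩)
    obtain ⟨y, hy, rfl⟩ := hexists hx hxM
    exact ⟨y, hy, rfl, by rw [← hform, hxmin]⟩
  · rintro ⟨y, hy, rfl, hymin⟩
    exact ⟨hvec hy, by rw [hform, hymin]⟩
end
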